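/- arXiv:2401.01287 — 2 statements merged into one kernel-verified Lean document; each statement's English description precedes it below -/
import Mathlib

section
/- For every two-element subset {i, j} ⊆ {1,2,3,4,5}, the reduced density matrix of the logical state |0̄⟩ of the five-qubit code on qubits i and j (obtained by tracing out the other three qubits from |0̄⟩⟨0̄|) is the maximally mixed state (1/4)·I₄; the same holds for |1̄⟩. -/
open scoped Matrix

/-- The computational basis vector `|abcde⟩` of `(ℂ²)^⊗5`, with configurations
of the five qubits represented as functions `Fin 5 → Fin 2`. -/
def basis5 (a b c d e : Fin 2) : (Fin 5 → Fin 2) → ℂ :=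
  fun g => if g = ![a, b, c, d, e] then 1 else 0

/-- The logical state `|0̄⟩` of the five-qubit code. -/
noncomputable def logicalZero : (Fin 5 → Fin 2) → ℂ :=
  ((1 : ℂ) / 4) •
    (basis5 0 0 0 0 0 + basis5 1 0 0 1 0 + basis5 0 1 0 0 1 + basis5 1 0 1 0 0
      + basis5 0 1 0 1 0 - basis5 1 1 0 1 1 - basis5 0 0 1 1 0 - basis5 1 1 0 0 0
      - basis5 1 1 1 0 1 - basis5 0 0 0 1 1 - basis5 1 1 1 1 0 - basis5 0 1 1 1 1
      - basis5 1 0 0 0 1 - basis5 0 1 1 0 0 - basis5 1 0 1 1 1 + basis5 0 0 1 0 1)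

/-- The logical state `|1̄⟩` of the five-qubit code. -/
noncomputable def logicalOne : (Fin 5 → Fin 2) → ℂ :=
  ((1 : ℂ) / 4) •
    (basis5 1 1 1 1 1 + basis5 0 1 1 0 1 + basis5 1 0 1 1 0 + basis5 0 1 0 1 1
      + basis5 1 0 1 0 1 - basis5 0 0 1 0 0 - basis5 1 1 0 0 1 - basis5 0 0 1 1 1
      - basis5 0 0 0 1 0 - basis5 1 1 1 0 0 - basis5 0 0 0 0 1 - basis5 1 0 0 0 0
      - basis5 0 1 1 1 0 - basis5 1 0 0 1 1 - basis5 0 1 0 0 0 + basis5 1 1 0 1 0)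

/-- The reduced density matrix of a pure state `v` of five qubits on the two
qubits `i` and `j`: the partial trace of `|v⟩⟨v|` over the other three qubits,
`ρ_{ab} = Σ_c v(a at i,j; c elsewhere) · conj (v(b at i,j; c elsewhere))`. -/
noncomputable def reducedTwo (i j : Fin 5) (v : (Fin 5 → Fin 2) → ℂ) :
    Matrix (Fin 2 × Fin 2) (Fin 2 × Fin 2) ℂ :=
  Matrix.of fun a b =>
    ∑ g : Fin 5 → Fin 2,
      if g i = a.1 ∧ g j = a.2 then
        v g * star (v (Function.update (Function.update g i b.1) j b.2))
      else 0

/-- The amplitudes of `|0̄⟩`, multiplied by `4`: the sign `(-1)^(Σ gₖ gₖ₊₁)` on configurations of even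
parity, and zero on the others. -/
def signZero (g : Fin 5 → Fin 2) : ℤ :=
  if g 0 + g 1 + g 2 + g 3 + g 4 = 0 then
    if g 0 * g 1 + g 1 * g 2 + g 2 * g 3 + g 3 * g 4 + g 4 * g 0 = 0 then 1 else -1
  else 0

/-- The amplitudes of `|1̄⟩`, multiplied by `4`. -/
def signOne (g : Fin 5 → Fin 2) : ℤ :=
  signZero fun k => g k + 1

/-- The integer analogue of `basis5`. -/
def intBasis5 (a b c d e : Fin 2) (g : Fin 5 → Fin 2) : ℤ :=
  if g = ![a, b, c, d, e] then 1 else 0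

theorem basis5_eq_intCast (a b c d e : Fin 2) (g : Fin 5 → Fin 2) :
    basis5 a b c d e g = (intBasis5 a b c d e g : ℂ) := by
  simp [basis5, intBasis5]

theorem signZero_eq_sum (g : Fin 5 → Fin 2) :
    signZero g = intBasis5 0 0 0 0 0 g + intBasis5 1 0 0 1 0 g + intBasis5 0 1 0 0 1 g
      + intBasis5 1 0 1 0 0 g + intBasis5 0 1 0 1 0 g - intBasis5 1 1 0 1 1 g
      - intBasis5 0 0 1 1 0 g - intBasis5 1 1 0 0 0 g - intBasis5 1 1 1 0 1 g
      - intBasis5 0 0 0 1 1 g - intBasis5 1 1 1 1 0 g - intBasis5 0 1 1 1 1 g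
      - intBasis5 1 0 0 0 1 g - intBasis5 0 1 1 0 0 g - intBasis5 1 0 1 1 1 g
      + intBasis5 0 0 1 0 1 g := by
  revert g
  decide +kernel

theorem signOne_eq_sum (g : Fin 5 → Fin 2) :
    signOne g = intBasis5 1 1 1 1 1 g + intBasis5 0 1 1 0 1 g + intBasis5 1 0 1 1 0 g
      + intBasis5 0 1 0 1 1 g + intBasis5 1 0 1 0 1 g - intBasis5 0 0 1 0 0 g
      - intBasis5 1 1 0 0 1 g - intBasis5 0 0 1 1 1 g - intBasis5 0 0 0 1 0 g
      - intBasis5 1 1 1 0 0 g - intBasis5 0 0 0 0 1 g - intBasis5 1 0 0 0 0 g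
      - intBasis5 0 1 1 1 0 g - intBasis5 1 0 0 1 1 g - intBasis5 0 1 0 0 0 g
      + intBasis5 1 1 0 1 0 g := by
  revert g
  decide +kernel

theorem logicalZero_apply (g : Fin 5 → Fin 2) : logicalZero g = 1 / 4 * (signZero g : ℂ) := by
  simp [logicalZero, signZero_eq_sum, basis5_eq_intCast]

theorem logicalOne_apply (g : Fin 5 → Fin 2) : logicalOne g = 1 / 4 * (signOne g : ℂ) := by
  simp [logicalOne, signOne_eq_sum, basis5_eq_intCast]

/-- The entries of the partial trace of `|s⟩⟨s|` for an integer vector `s`. -/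
def intReducedTwo (i j : Fin 5) (s : (Fin 5 → Fin 2) → ℤ) (a b : Fin 2 × Fin 2) : ℤ :=
  ∑ g : Fin 5 → Fin 2,
    if g i = a.1 ∧ g j = a.2 then
      s g * s (Function.update (Function.update g i b.1) j b.2)
    else 0

theorem reducedTwo_apply_of_eq_intCast {v : (Fin 5 → Fin 2) → ℂ} {s : (Fin 5 → Fin 2) → ℤ}
    (h : ∀ g, v g = 1 / 4 * (s g : ℂ)) (i j : Fin 5) (a b : Fin 2 × Fin 2) :
    reducedTwo i j v a b = 1 / 16 * (intReducedTwo i j s a b : ℂ) := by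
  simp only [reducedTwo, intReducedTwo, Matrix.of_apply, Int.cast_sum, Finset.mul_sum]
  refine Finset.sum_congr rfl fun g _ => ?_
  split_ifs
  · rw [h, h]
    simp
    ring
  · simp

theorem reducedTwo_eq_of_intReducedTwo_eq {v : (Fin 5 → Fin 2) → ℂ} {s : (Fin 5 → Fin 2) → ℤ}
    (h : ∀ g, v g = 1 / 4 * (s g : ℂ)) {i j : Fin 5}
    (hs : ∀ a b, intReducedTwo i j s a b = if a = b then 4 else 0) :
    reducedTwo i j v = ((1 : ℂ) / 4) • (1 : Matrix (Fin 2 × Fin 2) (Fin 2 × Fin 2) ℂ) := by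
  ext a b
  rw [reducedTwo_apply_of_eq_intCast h, hs, Matrix.smul_apply, Matrix.one_apply]
  split_ifs <;> norm_num

theorem signZero_comp_add (k : Fin 5) (g : Fin 5 → Fin 2) :
    signZero (fun l => g (l + k)) = signZero g := by
  revert k g
  decide +kernel

theorem intReducedTwo_add (k i j : Fin 5) (a b : Fin 2 × Fin 2) :
    intReducedTwo (i + k) (j + k) signZero a b = intReducedTwo i j signZero a b := by
  refine Fintype.sum_equiv ((Equiv.addRight k).symm.arrowCongr (Equiv.refl (Fin 2))) _ _ fun g => ?_
  have hg : (Equiv.addRight k).symm.arrowCongr (Equiv.refl (Fin 2)) g = fun l => g (l + k) := by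
    ext l
    simp
  have hu : (Function.update (Function.update (fun l => g (l + k)) i b.1) j b.2) =
      fun l => Function.update (Function.update g (i + k) b.1) (j + k) b.2 (l + k) := by
    ext l
    simp [Function.update_apply]
  rw [hg, hu, signZero_comp_add, signZero_comp_add]

theorem intReducedTwo_zero_signZero : ∀ j : Fin 5, 0 ≠ j → ∀ a b,
    intReducedTwo 0 j signZero a b = if a = b then 4 else 0 := by
  decide +kernel

theorem intReducedTwo_signZero {i j : Fin 5} (hij : i ≠ j) (a b : Fin 2 × Fin 2) :
    intReducedTwo i j signZero a b = if a = b then 4 else 0 := by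
  have h := intReducedTwo_add i 0 (j - i) a b
  rw [zero_add, sub_add_cancel] at h
  rw [h, intReducedTwo_zero_signZero _ (sub_ne_zero.mpr hij.symm).symm]

theorem intReducedTwo_signOne_eq (i j : Fin 5) (a b : Fin 2 × Fin 2) :
    intReducedTwo i j signOne a b = intReducedTwo i j signZero (a + 1) (b + 1) := by
  refine Fintype.sum_equiv (Equiv.addRight 1) _ _ fun g => ?_
  have hu : Function.update (Function.update (g + 1) i (b.1 + 1)) j (b.2 + 1) =
      fun l => Function.update (Function.update g i b.1) j b.2 l + 1 := by
    ext l
    simp only [Function.update_apply, Pi.add_apply, Pi.one_apply]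
    split_ifs <;> rfl
  simp only [Equiv.coe_addRight, Pi.add_apply, Pi.one_apply, Prod.fst_add, Prod.snd_add,
    Prod.fst_one, Prod.snd_one, add_left_inj, hu]
  rfl

theorem intReducedTwo_signOne {i j : Fin 5} (hij : i ≠ j) (a b : Fin 2 × Fin 2) :
    intReducedTwo i j signOne a b = if a = b then 4 else 0 := by
  rw [intReducedTwo_signOne_eq, intReducedTwo_signZero hij]
  simp only [add_left_inj]

/-- For every pair of distinct qubits `i, j`, the reduced
density matrix of each logical state of the five-qubit code on qubits `i` and
`j` is the maximally mixed state `(1/4)·I₄`. -/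
theorem reduced_two_qubit_state_maximally_mixed :
    ∀ i j : Fin 5, i ≠ j →
      reducedTwo i j logicalZero =
        ((1 : ℂ) / 4) • (1 : Matrix (Fin 2 × Fin 2) (Fin 2 × Fin 2) ℂ) ∧
      reducedTwo i j logicalOne =
        ((1 : ℂ) / 4) • (1 : Matrix (Fin 2 × Fin 2) (Fin 2 × Fin 2) ℂ) := by
  intro i j hij
  exact ⟨reducedTwo_eq_of_intReducedTwo_eq logicalZero_apply (intReducedTwo_signZero hij),
    reducedTwo_eq_of_intReducedTwo_eq logicalOne_apply (intReducedTwo_signOne hij)⟩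
end

section
/- Let |Ψ⟩ = (|0⟩⊗|0̄⟩ + |1⟩⊗|1̄⟩)/√2 ∈ ℂ² ⊗ (ℂ²)^⊗5 be the holographic state of the five-qubit code. For every three-element subset S of the six tensor factors, the reduced density matrix of |Ψ⟩⟨Ψ| on the factors in S (obtained by tracing out the other three factors) is the maximally mixed state (1/8)·I₈. In particular the six-qubit holographic state is absolutely maximally entangled. -/
open scoped Matrix

/-- The holographic state `|Ψ⟩ = (|0⟩⊗|0̄⟩ + |1⟩⊗|1̄⟩)/√2` of the five-qubit
code, a state of six qubits (factor `0` is the bulk/logical qubit and factors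
`1,…,5` are the five physical qubits). -/
noncomputable def holographicState : (Fin 6 → Fin 2) → ℂ :=
  fun g => (((Real.sqrt 2)⁻¹ : ℝ) : ℂ) *
    ((if g 0 = 0 then 1 else 0) * logicalZero (fun k : Fin 5 => g k.succ) +
     (if g 0 = 1 then 1 else 0) * logicalOne (fun k : Fin 5 => g k.succ))

/-- The reduced density matrix of a pure six-qubit state `v` on the three
factors `s 0, s 1, s 2`: the partial trace of `|v⟩⟨v|` over the other three
factors, `ρ_{ab} = Σ over configurations g, h agreeing outside the range of s
with `g = a`, `h = b` on it, of `v g · conj (v h)`. -/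
noncomputable def reducedThree (s : Fin 3 → Fin 6) (v : (Fin 6 → Fin 2) → ℂ) :
    Matrix (Fin 3 → Fin 2) (Fin 3 → Fin 2) ℂ :=
  Matrix.of fun a b =>
    ∑ g : Fin 6 → Fin 2, ∑ h : Fin 6 → Fin 2,
      if (∀ t, g (s t) = a t) ∧ (∀ t, h (s t) = b t) ∧
          (∀ k : Fin 6, (∀ t, s t ≠ k) → g k = h k)
      then v g * star (v h) else 0

/-- The parity of a six-qubit configuration. -/
def parity (g : Fin 6 → Fin 2) : Fin 2 := g 0 + g 1 + g 2 + g 3 + g 4 + g 5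

/-- The quadratic form giving the sign of an amplitude of the holographic state. -/
def phase (g : Fin 6 → Fin 2) : Fin 2 :=
  g 0 + (g 1 * g 2 + g 2 * g 3 + g 3 * g 4 + g 4 * g 5 + g 5 * g 1)

/-- The polar form of `phase`. -/
def phasePolar (d z : Fin 6 → Fin 2) : Fin 2 :=
  z 1 * (d 5 + d 2) + z 2 * (d 1 + d 3) + z 3 * (d 2 + d 4) + z 4 * (d 3 + d 5) +
    z 5 * (d 4 + d 1)

/-- The nontrivial character of `Fin 2`. -/
def signOf (x : Fin 2) : ℤ := if x = 0 then 1 else -1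

/-- The amplitudes of the holographic state, up to normalization. -/
def amplitude (g : Fin 6 → Fin 2) : ℤ := if parity g = 0 then signOf (phase g) else 0

theorem holographicState_eq_amplitude (g : Fin 6 → Fin 2) :
    holographicState g = (((Real.sqrt 2)⁻¹ : ℝ) : ℂ) * (1 / 4 * (amplitude g : ℂ)) := by
  unfold holographicState
  congr 1
  obtain ⟨a, b, c, d, e, f, rfl⟩ : ∃ a b c d e f, g = ![a, b, c, d, e, f] :=
    ⟨g 0, g 1, g 2, g 3, g 4, g 5, by ext k; fin_cases k <;> rfl⟩
  have ht : (fun k : Fin 5 => (![a, b, c, d, e, f] : Fin 6 → Fin 2) k.succ) =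
      ![b, c, d, e, f] := rfl
  rw [ht]
  fin_cases a <;> fin_cases b <;> fin_cases c <;> fin_cases d <;> fin_cases e <;> fin_cases f <;>
    simp [logicalZero, logicalOne, basis5, amplitude, parity, phase, signOf]

theorem signOf_add (x y : Fin 2) : signOf (x + y) = signOf x * signOf y := by
  revert x y; decide

theorem parity_add (g z : Fin 6 → Fin 2) : parity (g + z) = parity g + parity z := by
  simp only [parity, Pi.add_apply]
  abel

theorem phase_add_add_phase_add (g d z : Fin 6 → Fin 2) :
    phase (g + z) + phase (g + z + d) = phase g + phase (g + d) + phasePolar d z := by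
  simp only [phase, phasePolar, Pi.add_apply]
  open scoped Fin.CommRing in grind

/-- Shifting by an even `z` multiplies the correlation of the amplitudes at `g` and `g + d`
by the sign of the polar form. -/
theorem amplitude_mul_amplitude_shift (g d z : Fin 6 → Fin 2) (hz : parity z = 0) :
    amplitude (g + z) * amplitude (g + z + d) =
      signOf (phasePolar d z) * (amplitude g * amplitude (g + d)) := by
  have h := congrArg signOf (phase_add_add_phase_add g d z)
  simp only [signOf_add] at h
  simp only [amplitude, parity_add, hz, add_zero]
  split_ifs
  · rw [h]; ring
  all_goals simp

set_option synthInstance.maxSize 2000 in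
set_option maxRecDepth 100000 in
theorem exists_pair_phasePolar_eq_one : ∀ i j k : Fin 6, i ≠ j → i ≠ k → j ≠ k →
    ∀ x y w : Fin 2, x + y + w = 0 → ¬(x = 0 ∧ y = 0 ∧ w = 0) →
    ∃ m n : Fin 6, (m ≠ i ∧ m ≠ j ∧ m ≠ k) ∧ (n ≠ i ∧ n ≠ j ∧ n ≠ k) ∧
      phasePolar (Pi.single i x + Pi.single j y + Pi.single k w)
        (Pi.single m 1 + Pi.single n 1) = 1 := by
  decide

theorem extend_eq_sum_single {s : Fin 3 → Fin 6} (hs : Function.Injective s) (x : Fin 3 → Fin 2) :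
    Function.extend s x 0 =
      Pi.single (s 0) (x 0) + Pi.single (s 1) (x 1) + Pi.single (s 2) (x 2) := by
  ext1 k
  by_cases hk : ∃ t, s t = k
  · obtain ⟨t, rfl⟩ := hk
    rw [hs.extend_apply]
    fin_cases t <;> simp [hs.eq_iff]
  · rw [Function.extend_apply' _ _ _ hk]
    push Not at hk
    simp [fun t => (hk t).symm]

theorem reducedThree_apply {s : Fin 3 → Fin 6} (hs : Function.Injective s)
    (v : (Fin 6 → Fin 2) → ℂ) (a b : Fin 3 → Fin 2) :
    reducedThree s v a b =
      ∑ g, if g ∘ s = a then v g * star (v (g + Function.extend s (b - a) 0)) else 0 := by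
  have key (g h : Fin 6 → Fin 2) :
      ((∀ t, g (s t) = a t) ∧ (∀ t, h (s t) = b t) ∧ ∀ k, (∀ t, s t ≠ k) → g k = h k) ↔
        h = g + Function.extend s (b - a) 0 ∧ g ∘ s = a := by
    constructor
    · rintro ⟨hg, hh, hgh⟩
      refine ⟨funext fun k => ?_, funext hg⟩
      by_cases hk : ∃ t, s t = k
      · obtain ⟨t, rfl⟩ := hk
        simp [hs.extend_apply, hg, hh]
      · rw [Pi.add_apply, Function.extend_apply' _ _ _ hk]
        simpa using (hgh k (by simpa using hk)).symm
    · rintro ⟨rfl, rfl⟩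
      refine ⟨fun t => rfl, fun t => by simp [hs.extend_apply], fun k hk => ?_⟩
      rw [Pi.add_apply, Function.extend_apply' _ _ _ (by simpa using hk)]
      simp
  simp only [reducedThree, Matrix.of_apply]
  refine Finset.sum_congr rfl fun g _ => ?_
  simp_rw [key]
  simp [ite_and]

theorem sum_amplitude_mul_shift_eq_zero {s : Fin 3 → Fin 6} (hs : Function.Injective s)
    (a : Fin 3 → Fin 2) {x : Fin 3 → Fin 2} (hx : x ≠ 0) :
    ∑ g, (if g ∘ s = a then amplitude g * amplitude (g + Function.extend s x 0) else 0) = 0 := by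
  have hpar : parity (Function.extend s x 0) = x 0 + x 1 + x 2 := by
    have single (k : Fin 6) (y : Fin 2) : parity (Pi.single k y) = y := by
      fin_cases k <;> simp [parity]
    simp only [extend_eq_sum_single hs, parity_add, single]
  by_cases hodd : x 0 + x 1 + x 2 = 0
  · obtain ⟨m, n, hm, hn, hmn⟩ := exists_pair_phasePolar_eq_one (s 0) (s 1) (s 2)
      (hs.ne (by decide)) (hs.ne (by decide)) (hs.ne (by decide)) (x 0) (x 1) (x 2) hodd
      (fun h => hx (by ext t; fin_cases t <;> simp [h]))
    rw [← extend_eq_sum_single hs] at hmn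
    set z : Fin 6 → Fin 2 := Pi.single m 1 + Pi.single n 1 with hz
    have hzpar : parity z = 0 := by
      rw [hz, parity_add]
      clear * -
      revert m n; decide
    have hzs : z ∘ s = 0 := by
      ext1 t
      fin_cases t <;> simp [hz, hm.1.symm, hm.2.1.symm, hm.2.2.symm,
        hn.1.symm, hn.2.1.symm, hn.2.2.symm]
    have hfix (g : Fin 6 → Fin 2) : (g + z) ∘ s = g ∘ s := by
      rw [Pi.add_comp, hzs, add_zero]
    have hinv := Equiv.sum_comp (Equiv.addRight z) fun g : Fin 6 → Fin 2 =>
      if g ∘ s = a then amplitude g * amplitude (g + Function.extend s x 0) else 0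
    have hneg (g : Fin 6 → Fin 2) :
        (if (g + z) ∘ s = a then
          amplitude (g + z) * amplitude (g + z + Function.extend s x 0) else 0) =
        -(if g ∘ s = a then amplitude g * amplitude (g + Function.extend s x 0) else 0) := by
      rw [hfix, amplitude_mul_amplitude_shift _ _ _ hzpar, hmn]
      split_ifs <;> simp [signOf]
    have hsum := (Finset.sum_congr rfl fun g _ => hneg g).symm.trans hinv
    rw [Finset.sum_neg_distrib] at hsum
    linarith
  · refine Finset.sum_eq_zero fun g _ => ?_
    simp only [amplitude, parity_add, hpar]
    split_ifs <;> simp_all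

theorem card_fiber_comp {s : Fin 3 → Fin 6} (hs : Function.Injective s) (a : Fin 3 → Fin 2) :
    (Finset.univ.filter fun g : Fin 6 → Fin 2 => g ∘ s = a).card = 8 := by
  have : (Finset.univ.filter fun g : Fin 6 → Fin 2 => g ∘ s = a) =
      Fintype.piFinset fun k =>
        if k ∈ Finset.univ.image s then {Function.extend s a 0 k} else Finset.univ := by
    ext g
    simp only [Finset.mem_filter, Finset.mem_univ, true_and, Fintype.mem_piFinset]
    constructor
    · rintro rfl k
      split_ifs with hk
      · obtain ⟨t, -, rfl⟩ := Finset.mem_image.1 hk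
        simp [hs.extend_apply]
      · simp
    · intro h
      ext1 t
      simpa [hs.extend_apply] using h (s t)
  rw [this, Fintype.card_piFinset]
  simp only [apply_ite Finset.card, Finset.card_singleton, Finset.card_univ, Fintype.card_fin]
  rw [Finset.prod_ite, Finset.prod_const_one, one_mul, Finset.prod_const, Finset.filter_not,
    Finset.filter_mem_eq_inter, Finset.univ_inter, Finset.card_sdiff_of_subset (Finset.subset_univ _),
    Finset.card_image_of_injective _ hs]
  rfl

theorem sum_amplitude_mul_self {s : Fin 3 → Fin 6} (hs : Function.Injective s)
    (a : Fin 3 → Fin 2) :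
    ∑ g, (if g ∘ s = a then amplitude g * amplitude g else 0) = 4 := by
  obtain ⟨k, hk⟩ : ∃ k, ∀ t, s t ≠ k := by
    by_contra! h
    exact absurd (Fintype.card_le_of_surjective s h) (by simp)
  have hfix (g : Fin 6 → Fin 2) : (g + Pi.single k 1) ∘ s = g ∘ s := by
    ext1 t
    simp [hk t]
  have hone (g : Fin 6 → Fin 2) :
      amplitude (g + Pi.single k 1) * amplitude (g + Pi.single k 1) +
        amplitude g * amplitude g = 1 := by
    have hk : parity (Pi.single k 1) = 1 := by
      clear * -
      revert k; decide
    have hsign (x : Fin 2) : signOf x * signOf x = 1 := by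
      revert x; decide
    simp only [amplitude, parity_add, hk]
    obtain h | h : parity g = 0 ∨ parity g = 1 := by omega
    all_goals simp [h, hsign]
  have hflip := Equiv.sum_comp (Equiv.addRight (Pi.single k 1)) fun g : Fin 6 → Fin 2 =>
    if g ∘ s = a then amplitude g * amplitude g else 0
  simp only [Equiv.coe_addRight, hfix] at hflip
  have hcard : ∑ g : Fin 6 → Fin 2, (if g ∘ s = a then (1 : ℤ) else 0) = 8 := by
    rw [Finset.sum_boole, card_fiber_comp hs]; rfl
  have hadd : ∑ g : Fin 6 → Fin 2, (if g ∘ s = a then (1 : ℤ) else 0) =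
      (∑ g, if g ∘ s = a then
        amplitude (g + Pi.single k 1) * amplitude (g + Pi.single k 1) else 0) +
      ∑ g, if g ∘ s = a then amplitude g * amplitude g else 0 := by
    rw [← Finset.sum_add_distrib]
    refine Finset.sum_congr rfl fun g _ => ?_
    split_ifs
    · exact (hone g).symm
    · rfl
  linarith

theorem amplitude_correlation {s : Fin 3 → Fin 6} (hs : Function.Injective s)
    (a b : Fin 3 → Fin 2) :
    ∑ g, (if g ∘ s = a then amplitude g * amplitude (g + Function.extend s (b - a) 0) else 0) =
      if a = b then 4 else 0 := by
  split_ifs with h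
  · subst h
    have : Function.extend s (0 : Fin 3 → Fin 2) (0 : Fin 6 → Fin 2) = 0 := by
      simp [extend_eq_sum_single hs]
    simp only [sub_self, this, add_zero]
    exact sum_amplitude_mul_self hs a
  · exact sum_amplitude_mul_shift_eq_zero hs a (sub_ne_zero.2 (Ne.symm h))

/-- For every three-element subset of the six tensor factors
(given by an injection `s : Fin 3 → Fin 6`), the reduced density matrix of the
holographic state of the five-qubit code on those factors is the maximally
mixed state `(1/8)·I₈`: the state is absolutely maximally entangled. -/
theorem holographic_state_absolutely_maximally_entangled :
    ∀ s : Fin 3 → Fin 6, Function.Injective s →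
      reducedThree s holographicState =
        ((1 : ℂ) / 8) • (1 : Matrix (Fin 3 → Fin 2) (Fin 3 → Fin 2) ℂ) := by
  intro s hs
  ext a b
  have hnorm : (((Real.sqrt 2)⁻¹ : ℝ) : ℂ) * (((Real.sqrt 2)⁻¹ : ℝ) : ℂ) = 1 / 2 := by
    rw [← Complex.ofReal_mul, ← mul_inv, Real.mul_self_sqrt (by norm_num)]
    norm_num
  have hterm (g h : Fin 6 → Fin 2) :
      holographicState g * star (holographicState h) =
        1 / 32 * ((amplitude g * amplitude h : ℤ) : ℂ) := by
    simp only [holographicState_eq_amplitude, Complex.star_def, map_mul, Complex.conj_ofReal,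
      map_div₀, map_one, map_ofNat, map_intCast, Int.cast_mul]
    linear_combination (1 / 16 * (amplitude g : ℂ) * amplitude h) * hnorm
  have hsum := congrArg (fun n : ℤ => 1 / 32 * (n : ℂ)) (amplitude_correlation hs a b)
  simp only [Int.cast_sum, Int.cast_ite, Int.cast_zero, Finset.mul_sum, mul_ite, mul_zero,
    ← hterm, ← reducedThree_apply hs] at hsum
  rw [hsum, Matrix.smul_apply, Matrix.one_apply]
  split_ifs <;> norm_num
end
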